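/- arXiv:2201.06632 — 3 statements merged into one kernel-verified Lean document; each statement's English description precedes it below -/
import Mathlib

section
/- Let P_n^{(1,1)} denote the Jacobi polynomials with parameters (1,1). For all natural numbers i ≠ j, the weighted orthogonality relation ∫_{−1}^{1} (1−x)(1+x) · P_i^{(1,1)}(x) · P_j^{(1,1)}(x) dx = 0 holds. -/
open Set Polynomial

/-- `p` is the Jacobi polynomial `P_n^{(1,1)}`: a degree-`n` real polynomial agreeing on
`(-1, 1)` with the Rodrigues formula
`x ↦ ((-1)^n/(2^n n!)) (1-x)⁻¹ (1+x)⁻¹ (d/dx)^n [(1-x)^{n+1} (1+x)^{n+1}]`. -/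
def IsJacobi11 (n : ℕ) (p : Polynomial ℝ) : Prop :=
  p.degree = (n : WithBot ℕ) ∧
    ∀ x ∈ Ioo (-1 : ℝ) 1,
      p.eval x = ((-1 : ℝ) ^ n / (2 ^ n * n.factorial)) * ((1 - x))⁻¹ * ((1 + x))⁻¹ *
        iteratedDeriv n (fun y : ℝ => (1 - y) ^ (n + 1) * (1 + y) ^ (n + 1)) x

/-- Repeated integration by parts: if the derivatives of `w` of order less than `n` vanish at both
endpoints, then the `n`-th derivative of `w` is orthogonal to every polynomial killed by the
`n`-th derivative. -/
theorem integral_iterate_derivative_mul_eq_zero {a b : ℝ} {w : ℝ[X]} (n : ℕ) (q : ℝ[X])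
    (ha : ∀ k < n, (derivative^[k] w).eval a = 0) (hb : ∀ k < n, (derivative^[k] w).eval b = 0)
    (hq : derivative^[n] q = 0) :
    ∫ x in a..b, q.eval x * (derivative^[n] w).eval x = 0 := by
  induction n generalizing q with
  | zero =>
    rw [Function.iterate_zero_apply] at hq
    simp [hq]
  | succ n ih =>
    have hparts := intervalIntegral.integral_mul_deriv_eq_deriv_mul (a := a) (b := b)
      (fun x _ => q.hasDerivAt x) (fun x _ => (derivative^[n] w).hasDerivAt x)
      (derivative q).continuous.continuousOn.intervalIntegrable
      (derivative (derivative^[n] w)).continuous.continuousOn.intervalIntegrable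
    rw [Function.iterate_succ_apply', hparts, ha n n.lt_succ_self, hb n n.lt_succ_self,
      ih (derivative q) (fun k hk => ha k (hk.trans n.lt_succ_self))
        (fun k hk => hb k (hk.trans n.lt_succ_self)) (by rwa [Function.iterate_succ_apply] at hq)]
    simp

theorem iteratedDeriv_polynomial_eval (n : ℕ) (p : ℝ[X]) :
    iteratedDeriv n (fun x => p.eval x) = fun x => (derivative^[n] p).eval x := by
  induction n with
  | zero => simp
  | succ n ih =>
    ext x
    rw [iteratedDeriv_succ, ih, Polynomial.deriv, Function.iterate_succ_apply']

theorem eval_iterate_derivative_eq_zero_of_pow_dvd {a : ℝ} {n k : ℕ} {w : ℝ[X]}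
    (hw : (X - C a) ^ n ∣ w) (hk : k < n) : (derivative^[k] w).eval a = 0 := by
  have h := (dvd_pow_self (X - C a) (Nat.sub_ne_zero_of_lt hk)).trans
    (pow_sub_dvd_iterate_derivative_of_pow_dvd k hw)
  exact dvd_iff_isRoot.mp h

/-- A Jacobi polynomial `P_n^{(1,1)}` is orthogonal to all polynomials of smaller degree. -/
theorem IsJacobi11.integral_mul_eq_zero {n : ℕ} {p q : ℝ[X]} (hp : IsJacobi11 n p)
    (hq : derivative^[n] q = 0) :
    ∫ x in (-1 : ℝ)..1, (1 - x) * (1 + x) * p.eval x * q.eval x = 0 := by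
  set w : ℝ[X] := (1 - X) ^ (n + 1) * (1 + X) ^ (n + 1) with hw
  have hweval : (fun y : ℝ => (1 - y) ^ (n + 1) * (1 + y) ^ (n + 1)) = fun y => w.eval y := by
    ext y
    simp [hw]
  have hone : (X - C 1) ^ (n + 1) ∣ w :=
    (pow_dvd_pow_of_dvd ⟨-1, by rw [C_1]; ring⟩ _).mul_right _
  have hneg : (X - C (-1)) ^ (n + 1) ∣ w :=
    (pow_dvd_pow_of_dvd ⟨1, by rw [C_neg, C_1]; ring⟩ _).mul_left _
  have hparts := integral_iterate_derivative_mul_eq_zero (w := w) n q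
    (fun k hk => eval_iterate_derivative_eq_zero_of_pow_dvd hneg (hk.trans n.lt_succ_self))
    (fun k hk => eval_iterate_derivative_eq_zero_of_pow_dvd hone (hk.trans n.lt_succ_self)) hq
  have hcongr : ∫ x in (-1 : ℝ)..1, (1 - x) * (1 + x) * p.eval x * q.eval x =
      ∫ x in (-1 : ℝ)..1, ((-1 : ℝ) ^ n / (2 ^ n * n.factorial)) *
        (q.eval x * (derivative^[n] w).eval x) := by
    refine intervalIntegral.integral_congr_Ioo_of_le (by norm_num) fun x hx => ?_
    have hsub : 1 - x ≠ 0 := (sub_pos.mpr hx.2).ne'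
    have hadd : 1 + x ≠ 0 := (by linarith [hx.1] : 0 < 1 + x).ne'
    simp only [hp.2 x hx, hweval, iteratedDeriv_polynomial_eval]
    field_simp
  rw [hcongr, intervalIntegral.integral_const_mul, hparts, mul_zero]

/-- **Weighted orthogonality of the Jacobi polynomials `P_n^{(1,1)}`.**
For `i ≠ j`, `∫_{-1}^{1} (1-x)(1+x) P_i^{(1,1)}(x) P_j^{(1,1)}(x) dx = 0`. -/
theorem jacobi11_orthogonality (i j : ℕ) (hij : i ≠ j)
    (pi pj : Polynomial ℝ) (hpi : IsJacobi11 i pi) (hpj : IsJacobi11 j pj) :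
    ∫ x in (-1 : ℝ)..1, (1 - x) * (1 + x) * pi.eval x * pj.eval x = 0 := by
  rcases hij.lt_or_gt with h | h
  · simp_rw [mul_right_comm _ (pi.eval _) (pj.eval _)]
    exact hpj.integral_mul_eq_zero
      (iterate_derivative_eq_zero (by rwa [natDegree_eq_of_degree_eq_some hpi.1]))
  · exact hpi.integral_mul_eq_zero
      (iterate_derivative_eq_zero (by rwa [natDegree_eq_of_degree_eq_some hpj.1]))
end

section
/- Fix m ≥ 1 and consider the modal C⁰ basis φ_0, …, φ_m on [0,1]. For every bubble index i with 0 < i < m and every index j with 0 ≤ j ≤ m, the derivative orthonormality relation ∫_0^1 φ_i′(ξ) · φ_j′(ξ) dξ = δ_{ij} holds (Kronecker delta). In particular the bubble modes have L²(0,1)-orthonormal derivatives, and their derivatives are L²(0,1)-orthogonal to the derivatives of the nodal modes φ_0 and φ_m. -/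
open Set Polynomial

/-- The modal `C⁰` basis of order `m` on `[0,1]`, built from the family `J` of Jacobi
polynomials (`J n = P_n^{(1,1)}`): the nodal modes `φ_0(ξ) = 1 - ξ` and `φ_m(ξ) = ξ`, and
the bubble modes `φ_l(ξ) = -(√(2l+1)/l) ξ(1-ξ) P_{l-1}^{(1,1)}(2ξ-1)` for `0 < l < m`. -/
noncomputable def modalC0 (J : ℕ → Polynomial ℝ) (m l : ℕ) (ξ : ℝ) : ℝ :=
  if l = 0 then 1 - ξ
  else if l = m then ξ
  else -(Real.sqrt (2 * l + 1) / l) * (ξ * (1 - ξ)) * (J (l - 1)).eval (2 * ξ - 1)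

namespace Polynomial

theorem iteratedDeriv_eval (p : ℝ[X]) (n : ℕ) :
    iteratedDeriv n (fun x => p.eval x) = fun x => (derivative^[n] p).eval x := by
  induction n with
  | zero => simp
  | succ n ih =>
    ext x
    rw [iteratedDeriv_succ, ih, Function.iterate_succ_apply', Polynomial.deriv]

theorem iterate_derivative_comp_two_mul_X_sub_one (p : ℝ[X]) (n : ℕ) :
    derivative^[n] (p.comp (2 * X - 1)) = 2 ^ n * (derivative^[n] p).comp (2 * X - 1) := by
  induction n generalizing p with
  | zero => simp
  | succ n ih =>
    have h : derivative (p.comp (2 * X - 1)) = C 2 * (derivative p).comp (2 * X - 1) := by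
      simp [derivative_comp, C_ofNat]
    rw [Function.iterate_succ_apply, h, iterate_derivative_C_mul, ih, Function.iterate_succ_apply,
      C_ofNat]
    ring

theorem intervalIntegrable_eval (p : ℝ[X]) (a b : ℝ) :
    IntervalIntegrable (fun x => p.eval x) MeasureTheory.volume a b :=
  p.continuous.intervalIntegrable a b

theorem integral_eval_derivative (p : ℝ[X]) (a b : ℝ) :
    ∫ x in a..b, (derivative p).eval x = p.eval b - p.eval a :=
  intervalIntegral.integral_eq_sub_of_hasDerivAt (fun x _ => p.hasDerivAt x)
    (intervalIntegrable_eval _ a b)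

theorem integral_X_pow_mul_one_sub_X_pow (a b : ℕ) :
    ∫ x in (0 : ℝ)..1, x ^ a * (1 - x) ^ b =
      (a.factorial * b.factorial : ℝ) / (a + b + 1).factorial := by
  induction b generalizing a with
  | zero =>
    have : (a.factorial : ℝ) ≠ 0 := mod_cast a.factorial_ne_zero
    simp [Nat.factorial_succ]
    field_simp
  | succ b ih =>
    have key := integral_eval_derivative (X ^ (a + 1) * (1 - X) ^ (b + 1) : ℝ[X]) 0 1
    have e : ∀ x : ℝ, (derivative (X ^ (a + 1) * (1 - X) ^ (b + 1) : ℝ[X])).eval x =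
        (a + 1) * (x ^ a * (1 - x) ^ (b + 1)) - (b + 1) * (x ^ (a + 1) * (1 - x) ^ b) := by
      intro x
      simp [derivative_mul, derivative_pow]
      ring
    simp_rw [e] at key
    rw [intervalIntegral.integral_sub (by apply Continuous.intervalIntegrable; fun_prop)
      (by apply Continuous.intervalIntegrable; fun_prop),
      intervalIntegral.integral_const_mul, intervalIntegral.integral_const_mul, ih] at key
    simp only [eval_mul, eval_pow, eval_X, eval_sub, eval_one, sub_self, ne_eq, Nat.add_eq_zero_iff,
      one_ne_zero, and_false, not_false_eq_true, zero_pow, mul_zero, zero_mul] at key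
    have ha : (a + 1 : ℝ) ≠ 0 := by positivity
    apply mul_left_cancel₀ ha
    rw [sub_eq_zero.mp key, show a + 1 + b + 1 = a + (b + 1) + 1 by ring,
      Nat.factorial_succ a, Nat.factorial_succ b]
    push_cast
    ring

theorem integral_iterate_derivative_mul (w q : ℝ[X]) (k : ℕ)
    (h₀ : ∀ l < k, (derivative^[l] w).eval 0 = 0) (h₁ : ∀ l < k, (derivative^[l] w).eval 1 = 0) :
    ∫ x in (0 : ℝ)..1, (derivative^[k] w * q).eval x =
      (-1) ^ k * ∫ x in (0 : ℝ)..1, (w * derivative^[k] q).eval x := by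
  induction k generalizing q with
  | zero => simp
  | succ k ih =>
    have key := integral_eval_derivative (derivative^[k] w * q) 0 1
    rw [derivative_mul, ← Function.iterate_succ_apply' derivative k w] at key
    simp_rw [eval_add] at key
    rw [intervalIntegral.integral_add (intervalIntegrable_eval _ _ _)
      (intervalIntegrable_eval _ _ _), ih (derivative q) (fun l hl => h₀ l (by lia))
      (fun l hl => h₁ l (by lia)), ← Function.iterate_succ_apply derivative k q, eval_mul,
      eval_mul, h₀ k k.lt_succ_self, h₁ k k.lt_succ_self] at key
    rw [pow_succ]
    linarith

/-- The shifted Legendre polynomial with real coefficients. -/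
noncomputable def shiftedLegendreReal (n : ℕ) : ℝ[X] :=
  (shiftedLegendre n).map (Int.castRingHom ℝ)

theorem iterate_derivative_X_pow_mul_one_sub_X_pow (n : ℕ) :
    derivative^[n] (X ^ n * (1 - X) ^ n : ℝ[X]) = n.factorial * shiftedLegendreReal n := by
  have h := congrArg (map (Int.castRingHom ℝ)) (factorial_mul_shiftedLegendre_eq n)
  rw [← iterate_derivative_map] at h
  simpa [shiftedLegendreReal] using h.symm

theorem natDegree_shiftedLegendreReal_le (n : ℕ) : (shiftedLegendreReal n).natDegree ≤ n :=
  natDegree_map_le.trans (natDegree_shiftedLegendre n).le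

theorem iterate_derivative_shiftedLegendreReal (n : ℕ) :
    derivative^[n] (shiftedLegendreReal n) =
      C ((-1) ^ n * (n.factorial * (n + n).choose n : ℝ)) := by
  have hd := natDegree_iterate_derivative (shiftedLegendreReal n) n
  have hn := natDegree_shiftedLegendreReal_le n
  rw [eq_C_of_natDegree_le_zero (p := derivative^[n] (shiftedLegendreReal n)) (by lia),
    coeff_iterate_derivative]
  simp [shiftedLegendreReal, coeff_shiftedLegendre, Nat.descFactorial_self]
  ring

theorem integral_shiftedLegendreReal_mul (n : ℕ) (q : ℝ[X]) :
    ∫ x in (0 : ℝ)..1, (shiftedLegendreReal n * q).eval x =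
      (-1) ^ n / n.factorial *
        ∫ x in (0 : ℝ)..1, (X ^ n * (1 - X) ^ n * derivative^[n] q).eval x := by
  have h := integral_iterate_derivative_mul (X ^ n * (1 - X) ^ n) q n ?_ ?_
  · have hn : (n.factorial : ℝ) ≠ 0 := mod_cast n.factorial_ne_zero
    rw [iterate_derivative_X_pow_mul_one_sub_X_pow] at h
    simp_rw [mul_assoc (n.factorial : ℝ[X]), eval_natCast_mul] at h
    rw [intervalIntegral.integral_const_mul] at h
    rw [div_mul_eq_mul_div, ← h, mul_div_cancel_left₀ _ hn]
  · intro l hl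
    obtain ⟨r, hr⟩ := pow_sub_dvd_iterate_derivative_of_pow_dvd l
      (Dvd.intro _ rfl : (X : ℝ[X]) ^ n ∣ X ^ n * (1 - X) ^ n)
    simp [hr, zero_pow (Nat.sub_ne_zero_of_lt hl)]
  · intro l hl
    obtain ⟨r, hr⟩ := pow_sub_dvd_iterate_derivative_of_pow_dvd l
      (Dvd.intro_left _ rfl : (1 - X : ℝ[X]) ^ n ∣ X ^ n * (1 - X) ^ n)
    simp [hr, zero_pow (Nat.sub_ne_zero_of_lt hl)]

theorem integral_shiftedLegendreReal_mul_of_natDegree_lt {n : ℕ} {q : ℝ[X]}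
    (hq : q.natDegree < n) :
    ∫ x in (0 : ℝ)..1, (shiftedLegendreReal n).eval x * q.eval x = 0 := by
  simp_rw [← eval_mul]
  rw [integral_shiftedLegendreReal_mul, iterate_derivative_eq_zero hq]
  simp

theorem integral_shiftedLegendreReal_mul_self (n : ℕ) :
    ∫ x in (0 : ℝ)..1, (shiftedLegendreReal n).eval x * (shiftedLegendreReal n).eval x =
      1 / (2 * n + 1) := by
  simp_rw [← eval_mul]
  rw [integral_shiftedLegendreReal_mul, iterate_derivative_shiftedLegendreReal]
  simp_rw [eval_mul (q := C _), eval_C]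
  rw [intervalIntegral.integral_mul_const]
  simp only [eval_mul, eval_pow, eval_X, eval_sub, eval_one]
  rw [integral_X_pow_mul_one_sub_X_pow, Nat.add_choose, Nat.cast_div
    (Nat.factorial_mul_factorial_dvd_factorial_add n n) (by positivity), Nat.factorial_succ]
  have hs : ((-1 : ℝ) ^ n) * (-1) ^ n = 1 := by rw [← mul_pow]; simp
  have hn : (n.factorial : ℝ) ≠ 0 := mod_cast n.factorial_ne_zero
  have h2n : ((n + n).factorial : ℝ) ≠ 0 := mod_cast (n + n).factorial_ne_zero
  have h : (2 * n + 1 : ℝ) ≠ 0 := by positivity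
  push_cast
  rw [← two_mul (n : ℝ)]
  field_simp
  linear_combination hs

theorem integral_shiftedLegendreReal_mul_shiftedLegendreReal (i j : ℕ) :
    ∫ x in (0 : ℝ)..1, (shiftedLegendreReal i).eval x * (shiftedLegendreReal j).eval x =
      if i = j then 1 / (2 * i + 1 : ℝ) else 0 := by
  split_ifs with h
  · rw [← h, integral_shiftedLegendreReal_mul_self]
  · rcases lt_or_gt_of_ne h with h | h
    · simp_rw [mul_comm ((shiftedLegendreReal i).eval _)]
      exact integral_shiftedLegendreReal_mul_of_natDegree_lt
        ((natDegree_shiftedLegendreReal_le i).trans_lt h)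
    · exact integral_shiftedLegendreReal_mul_of_natDegree_lt
        ((natDegree_shiftedLegendreReal_le j).trans_lt h)

end Polynomial

theorem IsJacobi11.X_mul_one_sub_X_mul_comp {n : ℕ} {p : ℝ[X]} (hp : IsJacobi11 n p) :
    X * (1 - X) * p.comp (2 * X - 1) =
      C ((-1) ^ n / n.factorial : ℝ) * derivative^[n] (X ^ (n + 1) * (1 - X) ^ (n + 1)) := by
  apply eq_of_infinite_eval_eq
  refine (Ioo_infinite (zero_lt_one' ℝ)).mono fun x hx => ?_
  obtain ⟨hx₀, hx₁⟩ := hx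
  set w : ℝ[X] := (1 - X) ^ (n + 1) * (1 + X) ^ (n + 1) with hw
  have hwx : (fun y : ℝ => (1 - y) ^ (n + 1) * (1 + y) ^ (n + 1)) = fun y => w.eval y := by
    ext y; simp [hw]
  have hwc : w.comp (2 * X - 1) = C (4 ^ (n + 1)) * (X ^ (n + 1) * (1 - X) ^ (n + 1)) := by
    have h : (1 - (2 * X - 1) : ℝ[X]) * (1 + (2 * X - 1)) = 4 * (X * (1 - X)) := by ring
    simp only [hw, mul_comp, pow_comp, sub_comp, add_comp, one_comp, X_comp]
    rw [← mul_pow, h, mul_pow, mul_pow X, C_pow, C_ofNat]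
  have hd := congrArg (eval x) (iterate_derivative_comp_two_mul_X_sub_one w n)
  rw [hwc, iterate_derivative_C_mul] at hd
  have hJ := hp.2 (2 * x - 1) ⟨by linarith, by linarith⟩
  rw [hwx, congrFun (iteratedDeriv_eval w n)] at hJ
  simp only [eval_mul, eval_C, eval_pow, eval_comp, eval_sub, eval_X, eval_one, eval_ofNat,
    mem_ofPred_eq] at hd ⊢
  have hs : (2 : ℝ) ^ n * 2 ^ n = 4 ^ n := by rw [← mul_pow]; norm_num
  have hn : (n.factorial : ℝ) ≠ 0 := mod_cast n.factorial_ne_zero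
  have hx : x ≠ 0 := hx₀.ne'
  have hx' : 1 - x ≠ 0 := by linarith
  have hd' : eval (2 * x - 1) (derivative^[n] w) =
      2 ^ n * 4 * eval x (derivative^[n] (X ^ (n + 1) * (1 - X) ^ (n + 1))) := by
    apply mul_left_cancel₀ (pow_ne_zero n (two_ne_zero' ℝ))
    rw [← hd, pow_succ, ← hs]
    ring
  rw [hJ, hd', show 1 - (2 * x - 1) = 2 * (1 - x) by ring, show 1 + (2 * x - 1) = 2 * x by ring]
  field_simp
  norm_num

theorem deriv_modalC0_bubble {J : ℕ → ℝ[X]} {m l : ℕ} (hJ : IsJacobi11 (l - 1) (J (l - 1)))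
    (hl₀ : 0 < l) (hlm : l ≠ m) (ξ : ℝ) :
    deriv (modalC0 J m l) ξ =
      (-1) ^ l * Real.sqrt (2 * l + 1) * (shiftedLegendreReal l).eval ξ := by
  obtain ⟨n, rfl⟩ := Nat.exists_eq_add_one.mpr hl₀
  rw [Nat.add_sub_cancel] at hJ
  have h : modalC0 J m (n + 1) = fun ξ => (C (-(Real.sqrt (2 * (n + 1 : ℕ) + 1) / (n + 1 : ℕ))) *
      (X * (1 - X) * (J n).comp (2 * X - 1))).eval ξ := by
    ext ξ
    simp [modalC0, hlm]
    ring
  rw [h, Polynomial.deriv, hJ.X_mul_one_sub_X_mul_comp, derivative_C_mul, derivative_C_mul,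
    ← Function.iterate_succ_apply' derivative, iterate_derivative_X_pow_mul_one_sub_X_pow]
  simp only [eval_mul, eval_C, eval_natCast, Nat.factorial_succ]
  have hn : (n.factorial : ℝ) ≠ 0 := mod_cast n.factorial_ne_zero
  push_cast
  field_simp
  ring

theorem deriv_modalC0_zero (J : ℕ → ℝ[X]) (m : ℕ) (ξ : ℝ) : deriv (modalC0 J m 0) ξ = -1 := by
  have h : modalC0 J m 0 = fun ξ => 1 - ξ := by ext; simp [modalC0]
  simp [h]

theorem deriv_modalC0_last (J : ℕ → ℝ[X]) {m : ℕ} (hm : m ≠ 0) (ξ : ℝ) :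
    deriv (modalC0 J m m) ξ = 1 := by
  have h : modalC0 J m m = fun ξ => ξ := by ext; simp [modalC0, hm]
  simp [h]

theorem integral_deriv_modalC0_bubble_mul_const {J : ℕ → ℝ[X]} {m i : ℕ}
    (hJ : IsJacobi11 (i - 1) (J (i - 1))) (hi₀ : 0 < i) (him : i ≠ m) (c : ℝ) :
    ∫ ξ in (0 : ℝ)..1, deriv (modalC0 J m i) ξ * c = 0 := by
  have h := integral_shiftedLegendreReal_mul_of_natDegree_lt (n := i) (q := C c) (by simpa)
  simp_rw [eval_C] at h
  simp_rw [deriv_modalC0_bubble hJ hi₀ him, mul_assoc]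
  simp [h]

/-- **Derivative orthonormality of the bubble modes.** For `0 < i < m` and `0 ≤ j ≤ m`,
`∫_0^1 φ_i'(ξ) φ_j'(ξ) dξ = δ_{ij}`. -/
theorem modalC0_deriv_orthonormal (m : ℕ) (hm : 1 ≤ m)
    (J : ℕ → Polynomial ℝ) (hJ : ∀ n, IsJacobi11 n (J n))
    (i j : ℕ) (hi0 : 0 < i) (him : i < m) (hj : j ≤ m) :
    ∫ ξ in (0 : ℝ)..1, deriv (modalC0 J m i) ξ * deriv (modalC0 J m j) ξ =
      if i = j then 1 else 0 := by
  rcases Nat.eq_zero_or_pos j with rfl | hj₀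
  · simp_rw [deriv_modalC0_zero, if_neg hi0.ne']
    exact integral_deriv_modalC0_bubble_mul_const (hJ _) hi0 him.ne _
  rcases eq_or_ne j m with rfl | hjm
  · simp_rw [deriv_modalC0_last J hj₀.ne', if_neg him.ne]
    exact integral_deriv_modalC0_bubble_mul_const (hJ _) hi0 him.ne _
  simp_rw [deriv_modalC0_bubble (hJ _) hi0 him.ne, deriv_modalC0_bubble (hJ _) hj₀ hjm,
    mul_mul_mul_comm _ (eval _ _)]
  rw [intervalIntegral.integral_const_mul, integral_shiftedLegendreReal_mul_shiftedLegendreReal]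
  split_ifs with h
  · subst h
    have h : (2 * i + 1 : ℝ) ≠ 0 := by positivity
    rw [mul_mul_mul_comm, ← mul_pow, Real.mul_self_sqrt (by positivity)]
    field_simp
    simp
  · simp
end

section
/- Let m ≥ 1 and let x_0, …, x_m be m+1 pairwise distinct points in the interval [0,1]. Let ℓ_j(x) = ∏_{k ≠ j} (x − x_k)/(x_j − x_k) denote the associated Lagrange basis polynomials. Then for every real b > 1, max_{0 ≤ j ≤ m} |ℓ_j(b)| ≥ b^m / (m+1). In particular, the extrapolated values of the Lagrange basis functions at distance b from the unit interval grow at least like b^m. -/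
open Set Finset

/-- A monomial of degree less than the number of nodes equals its Lagrange interpolant. -/
theorem Lagrange.pow_eq_sum_pow_mul_prod {F ι : Type*} [Field F] [DecidableEq ι]
    {s : Finset ι} {v : ι → F} (hv : Set.InjOn v s) {n : ℕ} (hn : n < s.card) (b : F) :
    b ^ n = ∑ j ∈ s, v j ^ n * ∏ k ∈ s.erase j, (b - v k) / (v j - v k) := by
  have h := Lagrange.eq_interpolate (f := (Polynomial.X : Polynomial F) ^ n) hv
    (by rw [Polynomial.degree_X_pow]; exact_mod_cast hn)
  simpa [Lagrange.interpolate_apply, Polynomial.eval_finsetSum, Polynomial.eval_prod,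
    Lagrange.basis, Lagrange.basisDivisor, div_eq_inv_mul] using congrArg (Polynomial.eval b) h

/-- **Extrapolation blow-up of Lagrange basis functions.** Let `m ≥ 1` and let
`x_0, …, x_m` be pairwise distinct points in `[0,1]`, with Lagrange basis polynomials
`ℓ_j(x) = ∏_{k ≠ j} (x - x_k)/(x_j - x_k)`. Then for every `b > 1`,
`max_j |ℓ_j(b)| ≥ b^m / (m + 1)`. -/
theorem lagrange_extrapolation_blowup (m : ℕ) (hm : 1 ≤ m)
    (x : Fin (m + 1) → ℝ) (hx : Function.Injective x) (hx01 : ∀ j, x j ∈ Icc (0 : ℝ) 1)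
    (b : ℝ) (hb : 1 < b) :
    ∃ j : Fin (m + 1),
      b ^ m / (m + 1) ≤ |∏ k ∈ Finset.univ.erase j, (b - x k) / (x j - x k)| := by
  by_contra! h
  have hsum := Lagrange.pow_eq_sum_pow_mul_prod (s := Finset.univ) hx.injOn
    (n := m) (by simp) b
  refine lt_irrefl (b ^ m) ?_
  calc b ^ m ≤ |b ^ m| := le_abs_self _
    _ ≤ ∑ j, |x j ^ m * ∏ k ∈ Finset.univ.erase j, (b - x k) / (x j - x k)| := by
        rw [hsum]
        exact Finset.abs_sum_le_sum_abs _ _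
    _ ≤ ∑ j, |∏ k ∈ Finset.univ.erase j, (b - x k) / (x j - x k)| := by
        refine Finset.sum_le_sum fun j _ => ?_
        rw [abs_mul, abs_of_nonneg (pow_nonneg (hx01 j).1 m)]
        exact mul_le_of_le_one_left (abs_nonneg _) (pow_le_one₀ (hx01 j).1 (hx01 j).2)
    _ < ∑ _j : Fin (m + 1), b ^ m / (m + 1) :=
        Finset.sum_lt_sum_of_nonempty Finset.univ_nonempty fun j _ => h j
    _ = b ^ m := by
        rw [Finset.sum_const, Finset.card_univ, Fintype.card_fin, nsmul_eq_mul]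
        push_cast
        field_simp
end
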